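/- Let (X, dist) be a metric space, let ε > 0 and L > 0. Suppose that for every finite subset T' ⊆ X with |T'| ≥ 2 there exists an edge set S(T') on T' such that d_{S(T')}(x, y) ≤ (1 + ε) · dist(x, y) for all x, y ∈ T' and w(S(T')) ≤ L · mstw(T') (i.e., every terminal set has a subset (1+ε)-spanner of lightness at most L). Then for every nonempty finite T ⊆ X and every real ℓ > 0 there exists an edge set E on T such that w(E) ≤ L · |T| · ℓ and d_E(x, y) ≤ (1 + ε) · dist(x, y) for all distinct x, y ∈ T with dist(x, y) ≤ ℓ. -/

import Mathlib

open scoped ENNReal BigOperators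

universe u

/-- The distance function lifted to unordered pairs. -/
noncomputable def sym2Dist {X : Type u} [MetricSpace X] : Sym2 X → ℝ :=
  Sym2.lift ⟨fun x y => dist x y, fun _ _ => dist_comm _ _⟩

/-- The weight of an edge set: the sum of the distances of its pairs. -/
noncomputable def edgeWeight {X : Type u} [MetricSpace X] (E : Finset (Sym2 X)) : ℝ :=
  ∑ e ∈ E, sym2Dist e

/-- `E` is an edge set on `T`: a finite set of unordered pairs of distinct points of `T`. -/
def IsEdgeSetOn {X : Type u} (T : Finset X) (E : Finset (Sym2 X)) : Prop :=
  ∀ e ∈ E, ¬ e.IsDiag ∧ ∀ x ∈ e, x ∈ T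

/-- The length of the path starting at `p` and visiting the points of the list in order. -/
noncomputable def pathLength {X : Type u} [MetricSpace X] : X → List X → ℝ
  | _, [] => 0
  | p, x :: xs => dist p x + pathLength x xs

/-- `p :: l` is a path from `p` to `q` all of whose consecutive pairs are edges of `E`. -/
def IsPathIn {X : Type u} (E : Finset (Sym2 X)) (p q : X) (l : List X) : Prop :=
  List.Chain (fun a b => s(a, b) ∈ E) p l ∧ (p :: l).getLast (List.cons_ne_nil p l) = q

/-- The path-distance in the edge set `E`: the infimum in `[0, ∞]` of lengths of paths
in `E` from `p` to `q`. -/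
noncomputable def pathDist {X : Type u} [MetricSpace X] (E : Finset (Sym2 X)) (p q : X) :
    ℝ≥0∞ :=
  ⨅ (l : List X) (_ : IsPathIn E p q l), ENNReal.ofReal (pathLength p l)

/-- The minimum weight of an edge set on `T` connecting all points of `T` (MST weight). -/
noncomputable def mstw {X : Type u} [MetricSpace X] (T : Finset X) : ℝ :=
  sInf {w : ℝ | ∃ E : Finset (Sym2 X), IsEdgeSetOn T E ∧
    (∀ x ∈ T, ∀ y ∈ T, pathDist E x y < ⊤) ∧ w = edgeWeight E}

lemma sym2Dist_nonneg {X : Type u} [MetricSpace X] (e : Sym2 X) : 0 ≤ sym2Dist e := by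
  induction e using Sym2.ind with
  | _ x y => exact dist_nonneg

lemma edgeWeight_nonneg {X : Type u} [MetricSpace X] (E : Finset (Sym2 X)) : 0 ≤ edgeWeight E :=
  Finset.sum_nonneg fun e _ => sym2Dist_nonneg e

lemma pathDist_mono {X : Type u} [MetricSpace X] {E F : Finset (Sym2 X)} (h : E ⊆ F) (p q : X) :
    pathDist F p q ≤ pathDist E p q := by
  unfold pathDist
  refine le_iInf fun l => le_iInf fun hl => ?_
  exact iInf₂_le l ⟨List.IsChain.imp (fun a b hab => h hab) hl.1, hl.2⟩

lemma pathDist_lt_top_of_reach {X : Type u} [MetricSpace X] {E : Finset (Sym2 X)} {p q : X}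
    (h : Relation.ReflTransGen (fun a b => s(a, b) ∈ E) p q) : pathDist E p q < ⊤ := by
  obtain ⟨l, hl, hq⟩ := List.exists_isChain_cons_of_relationReflTransGen h
  exact lt_of_le_of_lt (iInf₂_le l ⟨hl, hq⟩) ENNReal.ofReal_lt_top

/-- `C` carries a connected edge set, rooted at `r`, of weight at most `|C| ℓ`. -/
def GoodSet {X : Type u} [MetricSpace X] (ℓ : ℝ) (r : X) (C : Finset X) : Prop :=
  ∃ F : Finset (Sym2 X), IsEdgeSetOn C F ∧
    (∀ x ∈ C, Relation.ReflTransGen (fun a b => s(a, b) ∈ F) r x) ∧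
    edgeWeight F ≤ C.card * ℓ

lemma GoodSet.mstw_le {X : Type u} [MetricSpace X] {ℓ : ℝ} {r : X} {C : Finset X}
    (h : GoodSet ℓ r C) : mstw C ≤ C.card * ℓ := by
  obtain ⟨F, hF, hr, hw⟩ := h
  refine le_trans (csInf_le ⟨0, ?_⟩ ⟨F, hF, ?_, rfl⟩) hw
  · rintro _ ⟨E, _, _, rfl⟩
    exact edgeWeight_nonneg E
  · intro x hx y hy
    refine pathDist_lt_top_of_reach (Relation.ReflTransGen.trans ?_ (hr y hy))
    have hs : Std.Symm (fun a b => s(a, b) ∈ F) := ⟨fun a b hab => by rwa [Sym2.eq_swap]⟩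
    exact Relation.ReflTransGen.stdSymm.symm _ _ (hr x hx)

open Classical in
lemma GoodSet.insert {X : Type u} [MetricSpace X] {ℓ : ℝ} {r : X} {C : Finset X}
    (h : GoodSet ℓ r C) {c y : X} (hc : c ∈ C) (hy : y ∉ C) (hd : dist c y ≤ ℓ) :
    GoodSet ℓ r (Insert.insert y C) := by
  obtain ⟨F, hF, hr, hw⟩ := h
  have hcy : c ≠ y := fun h => hy (h ▸ hc)
  refine ⟨Insert.insert s(c, y) F, ?_, ?_, ?_⟩
  · intro e he
    rcases Finset.mem_insert.1 he with rfl | he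
    · refine ⟨by simpa using hcy, ?_⟩
      intro x hx
      rcases Sym2.mem_iff.1 hx with rfl | rfl <;> simp [hc]
    · exact ⟨(hF e he).1, fun x hx => Finset.mem_insert_of_mem ((hF e he).2 x hx)⟩
  · have hr' : ∀ x ∈ C, Relation.ReflTransGen
        (fun a b => s(a, b) ∈ Insert.insert s(c, y) F) r x := fun x hx =>
      Relation.ReflTransGen.mono (fun a b hab => Finset.mem_insert_of_mem hab) _ _ (hr x hx)
    intro x hx
    rcases Finset.mem_insert.1 hx with rfl | hx
    · exact (hr' c hc).tail (Finset.mem_insert_self _ _)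
    · exact hr' x hx
  · have hn : s(c, y) ∉ F := fun h => hy ((hF _ h).2 y (by simp))
    have h1 : sym2Dist s(c, y) = dist c y := rfl
    unfold edgeWeight at hw ⊢
    rw [Finset.sum_insert hn, Finset.card_insert_of_notMem hy, h1]
    push_cast
    linarith

/-- Light subset spanners imply sparse spanner oracles. -/
theorem light_subset_spanner_implies_sparse_oracle {X : Type u} [MetricSpace X]
    (ε L : ℝ) (hε : 0 < ε) (hL : 0 < L)
    (hspan : ∀ T' : Finset X, 2 ≤ T'.card →
      ∃ S : Finset (Sym2 X), IsEdgeSetOn T' S ∧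
        (∀ x ∈ T', ∀ y ∈ T', pathDist S x y ≤ ENNReal.ofReal ((1 + ε) * dist x y)) ∧
        edgeWeight S ≤ L * mstw T') :
    ∀ T : Finset X, T.Nonempty → ∀ ℓ : ℝ, 0 < ℓ →
      ∃ E : Finset (Sym2 X), IsEdgeSetOn T E ∧
        edgeWeight E ≤ L * T.card * ℓ ∧
        ∀ x ∈ T, ∀ y ∈ T, x ≠ y → dist x y ≤ ℓ →
          pathDist E x y ≤ ENNReal.ofReal ((1 + ε) * dist x y) := by
  classical
  intro T _ ℓ hℓ
  clear * - hε hL hspan hℓ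
  induction T using Finset.strongInduction with
  | H T ih =>
  rcases T.eq_empty_or_nonempty with rfl | ⟨r, hr⟩
  · exact ⟨∅, by simp [IsEdgeSetOn], by simp [edgeWeight], by simp⟩
  have hne : (T.powerset.filter fun C => r ∈ C ∧ GoodSet ℓ r C).Nonempty := by
    refine ⟨{r}, by
      simp only [Finset.mem_filter, Finset.mem_powerset, Finset.singleton_subset_iff, hr,
        Finset.mem_singleton, true_and]
      refine ⟨∅, by simp [IsEdgeSetOn], ?_, by simp [edgeWeight, hℓ.le]⟩
      intro x hx
      rw [Finset.mem_singleton.1 hx]⟩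
  obtain ⟨C, hC, hmax⟩ := Finset.exists_max_image _ Finset.card hne
  simp only [Finset.mem_filter, Finset.mem_powerset] at hC hmax
  obtain ⟨hCT, hrC, hgood⟩ := hC
  have hsep : ∀ c ∈ C, ∀ y ∈ T, y ∉ C → ¬ dist c y ≤ ℓ := by
    intro c hc y hy hyC hd
    have := hmax (insert y C) ⟨Finset.insert_subset hy hCT, Finset.mem_insert_of_mem hrC,
      hgood.insert hc hyC hd⟩
    rw [Finset.card_insert_of_notMem hyC] at this
    omega
  obtain ⟨E₁, hE₁, hw₁, hp₁⟩ := ih (T \ C)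
    (Finset.sdiff_ssubset hCT ⟨r, hrC⟩)
  have hS : ∃ S : Finset (Sym2 X), IsEdgeSetOn C S ∧ edgeWeight S ≤ L * (C.card * ℓ) ∧
      ∀ x ∈ C, ∀ y ∈ C, x ≠ y → pathDist S x y ≤ ENNReal.ofReal ((1 + ε) * dist x y) := by
    by_cases h2 : 2 ≤ C.card
    · obtain ⟨S, h1, h3, h4⟩ := hspan C h2
      exact ⟨S, h1, h4.trans (mul_le_mul_of_nonneg_left hgood.mstw_le hL.le),
        fun x hx y hy _ => h3 x hx y hy⟩
    · refine ⟨∅, by simp [IsEdgeSetOn], ?_, ?_⟩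
      · simp only [edgeWeight, Finset.sum_empty]
        positivity
      · intro x hx y hy hxy
        exact absurd (Finset.card_le_one.1 (by omega) x hx y hy) hxy
  obtain ⟨S, hS₁, hS₂, hS₃⟩ := hS
  refine ⟨S ∪ E₁, ?_, ?_, ?_⟩
  · intro e he
    rcases Finset.mem_union.1 he with he | he
    · exact ⟨(hS₁ e he).1, fun x hx => hCT ((hS₁ e he).2 x hx)⟩
    · exact ⟨(hE₁ e he).1, fun x hx => (Finset.mem_sdiff.1 ((hE₁ e he).2 x hx)).1⟩
  · have hu : edgeWeight (S ∪ E₁) + edgeWeight (S ∩ E₁) = edgeWeight S + edgeWeight E₁ :=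
      Finset.sum_union_inter
    have hi := edgeWeight_nonneg (S ∩ E₁)
    have hcard : ((T \ C).card : ℝ) + C.card = T.card := by
      exact_mod_cast Finset.card_sdiff_add_card_eq_card hCT
    rw [← hcard]
    linarith
  · intro x hx y hy hxy hd
    by_cases hxC : x ∈ C
    · by_cases hyC : y ∈ C
      · exact (pathDist_mono Finset.subset_union_left x y).trans (hS₃ x hxC y hyC hxy)
      · exact absurd hd (hsep x hxC y hy hyC)
    · by_cases hyC : y ∈ C
      · exact absurd (dist_comm x y ▸ hd) (hsep y hyC x hx hxC)
      · exact (pathDist_mono Finset.subset_union_right x y).trans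
          (hp₁ x (Finset.mem_sdiff.2 ⟨hx, hxC⟩) y (Finset.mem_sdiff.2 ⟨hy, hyC⟩) hxy hd)
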